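/- Let U ⊆ ℝⁿ be open and let L be an even r-form on U. Define ΔL : U × Matrix((r+1)×n, ℝ) → ℝ by ΔL(x, (ẋ; ẏ)) := (−1)^r Σ_{A=1}^{n} ẏ^A ( (∂L/∂x^A)(x, ẋ) − Σ_{F=1}^{r} Σ_{B=1}^{n} ẋ_F^B (∂²L/∂x^B∂ẋ_F^A)(x, ẋ) ), where ẋ consists of the first r rows and ẏ is the last row of the (r+1)×n argument. Then ΔL is an even (r+1)-form on U, and Δ(ΔL) = 0. -/

import Mathlib

open MeasureTheory
open scoped BigOperators

noncomputable section

/-- Product of matrices given as functions (entry `(i,k)` is `∑ j, M i j * N j k`). -/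
def mmul {a b c : ℕ} (M : Fin a → Fin b → ℝ) (N : Fin b → Fin c → ℝ) :
    Fin a → Fin c → ℝ :=
  fun i k => ∑ j, M i j * N j k

/-- Determinant of a square matrix given as a function. -/
def fdet {a : ℕ} (M : Fin a → Fin a → ℝ) : ℝ :=
  Matrix.det (Matrix.of M)

/-- Partial derivative of a function of a matrix with respect to the `(i,j)` entry. -/
def pdM {a b : ℕ} (L : (Fin a → Fin b → ℝ) → ℝ) (i : Fin a) (j : Fin b)
    (m : Fin a → Fin b → ℝ) : ℝ :=
  deriv (fun t : ℝ => L (fun i' j' => m i' j' + (if i' = i ∧ j' = j then t else 0))) 0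

/-- Partial derivative of a function of a vector with respect to the `i`-th coordinate. -/
def pdV {a : ℕ} (f : (Fin a → ℝ) → ℝ) (i : Fin a) (x : Fin a → ℝ) : ℝ :=
  deriv (fun t : ℝ => f (fun i' => x i' + (if i' = i then t else 0))) 0

/-- The fundamental equations for a function of an `a × b` matrix:
for all rows `i₁, i₂` and columns `j₁, j₂`,
`∂²L/∂m_{i₁}^{j₁}∂m_{i₂}^{j₂} + ∂²L/∂m_{i₂}^{j₁}∂m_{i₁}^{j₂} = 0`. -/
def FundEqs {a b : ℕ} (L : (Fin a → Fin b → ℝ) → ℝ) : Prop :=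
  ∀ (i₁ i₂ : Fin a) (j₁ j₂ : Fin b) (m : Fin a → Fin b → ℝ),
    pdM (fun m' => pdM L i₂ j₂ m') i₁ j₁ m + pdM (fun m' => pdM L i₁ j₂ m') i₂ j₁ m = 0

/-- The velocity matrix of a path `γ`: `(vel γ t) F A = ∂γ^A/∂t^F (t)`. -/
def vel {r n : ℕ} (γ : (Fin r → ℝ) → (Fin n → ℝ)) (t : Fin r → ℝ) :
    Fin r → Fin n → ℝ :=
  fun F A => pdV (fun s => γ s A) F t

/-- The matrix of gradients of a copath `f`: `(grad f x) A K = ∂f^K/∂x^A (x)`. -/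
def grad {n k : ℕ} (f : (Fin n → ℝ) → (Fin k → ℝ)) (x : Fin n → ℝ) :
    Fin n → Fin k → ℝ :=
  fun A K => pdV (fun y => f y K) A x

/-- An even `r`-form on an open set `U ⊆ ℝⁿ`: a smooth function `L(x, ẋ)` of a point
`x` and an `r × n` matrix `ẋ` which is covariant (`L(x, h·ẋ) = det h · L(x, ẋ)` for
invertible `h`) and satisfies the fundamental equations in the entries of `ẋ`. -/
def IsEvenForm {n r : ℕ} (U : Set (Fin n → ℝ))
    (L : (Fin n → ℝ) → (Fin r → Fin n → ℝ) → ℝ) : Prop :=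
  ContDiffOn ℝ (⊤ : ℕ∞)
      (fun q : (Fin n → ℝ) × (Fin r → Fin n → ℝ) => L q.1 q.2)
      (U ×ˢ (Set.univ : Set (Fin r → Fin n → ℝ))) ∧
  (∀ x ∈ U, ∀ (xdot : Fin r → Fin n → ℝ) (h : Fin r → Fin r → ℝ), fdet h ≠ 0 →
    L x (mmul h xdot) = fdet h * L x xdot) ∧
  (∀ x ∈ U, FundEqs (L x))

/-- The differential of a Lagrangian of paths `L(x, ẋ)`:
`ΔL(x, (ẋ; ẏ)) = (−1)^r Σ_A ẏ^A (∂L/∂x^A − Σ_{F,B} ẋ_F^B ∂²L/∂x^B∂ẋ_F^A)`,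
where `ẋ` consists of the first `r` rows and `ẏ` is the last row of the argument. -/
def Dform {n r : ℕ} (L : (Fin n → ℝ) → (Fin r → Fin n → ℝ) → ℝ) :
    (Fin n → ℝ) → (Fin (r + 1) → Fin n → ℝ) → ℝ :=
  fun x M => (-1 : ℝ) ^ r * ∑ A, M (Fin.last r) A *
    (pdV (fun x' => L x' (fun F => M (Fin.castSucc F))) A x
      - ∑ F, ∑ B, M (Fin.castSucc F) B *
          pdV (fun x' => pdM (L x') F A (fun G => M (Fin.castSucc G))) B x)

/-- An even mixed form of codegree `k` and additional degree `r` on an open set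
`U ⊆ ℝⁿ`: a smooth function `𝓛(x, p, w)` which is right-covariant, left-covariant,
admissible, and satisfies the fundamental equations in the entries of the stacked
`(n+r) × k` matrix (`p` over `w`). -/
def IsMixedForm {n k r : ℕ} (U : Set (Fin n → ℝ))
    (L : (Fin n → ℝ) → (Fin n → Fin k → ℝ) → (Fin r → Fin k → ℝ) → ℝ) : Prop :=
  ContDiffOn ℝ (⊤ : ℕ∞)
      (fun q : (Fin n → ℝ) × (Fin n → Fin k → ℝ) × (Fin r → Fin k → ℝ) =>
        L q.1 q.2.1 q.2.2)
      (U ×ˢ (Set.univ : Set ((Fin n → Fin k → ℝ) × (Fin r → Fin k → ℝ)))) ∧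
  (∀ x ∈ U, ∀ (p : Fin n → Fin k → ℝ) (w : Fin r → Fin k → ℝ) (g : Fin k → Fin k → ℝ),
    fdet g ≠ 0 → L x (mmul p g) (mmul w g) = fdet g * L x p w) ∧
  (∀ x ∈ U, ∀ (p : Fin n → Fin k → ℝ) (w : Fin r → Fin k → ℝ) (h : Fin r → Fin r → ℝ),
    fdet h ≠ 0 → L x p (mmul h w) = fdet h * L x p w) ∧
  (∀ x ∈ U, ∀ (p : Fin n → Fin k → ℝ) (w : Fin r → Fin k → ℝ) (a : Fin n → Fin r → ℝ),
    L x (p + mmul a w) w = L x p w) ∧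
  (∀ x ∈ U, FundEqs (fun m : Fin (n + r) → Fin k → ℝ =>
    L x (fun A => m (Fin.castAdd r A)) (fun F => m (Fin.natAdd n F))))

/-- The differential of a mixed Lagrangian `𝓛(x, p, w)`:
`Δ𝓛(x, p, ŵ) = (−1)^r Σ_{K,A} w'^K ∂²𝓛/∂x^A∂p_A^K (x, p, w)`, where `ŵ` has first
`r` rows `w` and last row `w'`. -/
def Dmix {n k r : ℕ}
    (L : (Fin n → ℝ) → (Fin n → Fin k → ℝ) → (Fin r → Fin k → ℝ) → ℝ) :
    (Fin n → ℝ) → (Fin n → Fin k → ℝ) → (Fin (r + 1) → Fin k → ℝ) → ℝ :=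
  fun x p what => (-1 : ℝ) ^ r * ∑ K, ∑ A, what (Fin.last r) K *
    pdV (fun x' => pdM (fun p' => L x' p' (fun F => what (Fin.castSucc F))) A K p) A x

/-- An even dual form of codegree `k` on an open set `U ⊆ ℝⁿ`: a smooth function
`𝓛(x, p)` of a point `x` and an `n × k` matrix `p` of momenta which is covariant
(`𝓛(x, p·g) = det g · 𝓛(x, p)` for invertible `g`) and satisfies the fundamental
equations in the entries of `p`. -/
def IsDualForm {n k : ℕ} (U : Set (Fin n → ℝ))
    (L : (Fin n → ℝ) → (Fin n → Fin k → ℝ) → ℝ) : Prop :=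
  ContDiffOn ℝ (⊤ : ℕ∞)
      (fun q : (Fin n → ℝ) × (Fin n → Fin k → ℝ) => L q.1 q.2)
      (U ×ˢ (Set.univ : Set (Fin n → Fin k → ℝ))) ∧
  (∀ x ∈ U, ∀ (p : Fin n → Fin k → ℝ) (g : Fin k → Fin k → ℝ), fdet g ≠ 0 →
    L x (mmul p g) = fdet g * L x p) ∧
  (∀ x ∈ U, FundEqs (L x))

/-- The identity matrix as a function. -/
def idm (n : ℕ) : Fin n → Fin n → ℝ := fun i j => if i = j then 1 else 0

open scoped Topology

theorem pdV_eq_fderiv {a : ℕ} {f : (Fin a → ℝ) → ℝ} {x : Fin a → ℝ}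
    (hf : DifferentiableAt ℝ f x) (i : Fin a) :
    pdV f i x = fderiv ℝ f x (Pi.single i 1) := by
  have hline : ∀ t : ℝ,
      (fun i' => x i' + (if i' = i then t else 0)) = x + t • Pi.single i (1 : ℝ) := by
    intro t
    ext j
    by_cases hj : j = i
    · subst hj; simp
    · simp [hj]
  simp only [pdV, hline]
  exact (hf.hasFDerivAt.hasLineDerivAt (Pi.single i 1)).lineDeriv

/-- The derivative of a multilinear function in the direction of a matrix unit. -/
theorem pdM_multilinear {a b : ℕ}
    (f : MultilinearMap ℝ (fun _ : Fin a => Fin b → ℝ) ℝ) (i : Fin a) (j : Fin b)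
    (m : Fin a → Fin b → ℝ) :
    pdM f i j m = f (Function.update m i (Pi.single j 1)) := by
  have hline : ∀ t : ℝ, (fun i' j' => m i' j' + (if i' = i ∧ j' = j then t else 0))
      = Function.update m i (m i + t • Pi.single j (1 : ℝ)) := by
    intro t
    ext i' j'
    by_cases hi : i' = i
    · subst hi
      by_cases hj : j' = j
      · subst hj; simp
      · simp [hj]
    · simp [hi]
  simp only [pdM, hline, f.map_update_add, f.map_update_smul, Function.update_eq_self, smul_eq_mul]
  simp

theorem fundEqs_alternating {a b : ℕ} (f : (Fin b → ℝ) [⋀^Fin a]→ₗ[ℝ] ℝ) : FundEqs f := by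
  have hpd : ∀ i j, pdM f i j = fun m => f (Function.update m i (Pi.single j 1)) :=
    fun i j => funext fun m => pdM_multilinear f.toMultilinearMap i j m
  intro i₁ i₂ j₁ j₂ m
  simp only [hpd]
  rcases eq_or_ne i₁ i₂ with rfl | hne
  · have hconst : pdM (fun m' => f (Function.update m' i₁ (Pi.single j₂ 1))) i₁ j₁ m = 0 := by
      have hupd : ∀ t : ℝ, Function.update
          (fun i' j' => m i' j' + (if i' = i₁ ∧ j' = j₁ then t else 0)) i₁ (Pi.single j₂ (1 : ℝ))
          = Function.update m i₁ (Pi.single j₂ 1) := by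
        intro t
        ext i' j'
        by_cases hi : i' = i₁
        · subst hi; simp
        · simp [hi]
      simp [pdM, hupd]
    rw [hconst, add_zero]
  · have hsecond : ∀ i i' : Fin a, i ≠ i' →
        pdM (fun m' => f (Function.update m' i' (Pi.single j₂ 1))) i j₁ m
          = f (Function.update (Function.update m i' (Pi.single j₂ 1)) i (Pi.single j₁ 1)) := by
      intro i i' h
      refine Eq.trans ?_ (pdM_multilinear f.toMultilinearMap i j₁
        (Function.update m i' (Pi.single j₂ 1)))
      simp only [pdM]
      congr 1
      funext t
      change f _ = f _
      congr 1
      ext k l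
      by_cases hk : k = i'
      · subst hk; simp [h.symm]
      · simp [hk]
    have hswap : (Function.update (Function.update m i₁ (Pi.single j₂ 1)) i₂ (Pi.single j₁ 1) :
          Fin a → Fin b → ℝ)
        = (Function.update (Function.update m i₂ (Pi.single j₂ 1)) i₁ (Pi.single j₁ 1) :
          Fin a → Fin b → ℝ) ∘ Equiv.swap i₁ i₂ := by
      ext k l
      by_cases h1 : k = i₁
      · subst h1; simp [hne, hne.symm]
      · by_cases h2 : k = i₂
        · subst h2; simp
        · simp [h1, h2, Equiv.swap_apply_of_ne_of_ne]
    rw [hsecond _ _ hne, hsecond _ _ hne.symm, hswap, f.map_swap _ hne, add_neg_cancel]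

theorem alternating_mmul {a b : ℕ} (f : (Fin b → ℝ) [⋀^Fin a]→ₗ[ℝ] ℝ)
    (h : Fin a → Fin a → ℝ) (m : Fin a → Fin b → ℝ) :
    f (mmul h m) = fdet h * f m := by
  have hrow : ∀ k : Fin a → Fin a → ℝ,
      mmul k m = fun i => Fintype.linearCombination ℝ m (k i) := by
    intro k
    ext i j
    simp [mmul, Fintype.linearCombination_apply]
  have hdet := (f.compLinearMap (Fintype.linearCombination ℝ m)).eq_smul_basis_det
    (Pi.basisFun ℝ (Fin a))
  have := congrArg (fun g => g h) hdet
  simp only [AlternatingMap.compLinearMap_apply, AlternatingMap.smul_apply, smul_eq_mul,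
    Pi.basisFun_det_apply] at this
  rw [hrow, this, mul_comm]
  simp [fdet, Fintype.linearCombination_apply_single, Matrix.of]

theorem isEvenForm_of_alternating {n r : ℕ} {U : Set (Fin n → ℝ)}
    {L : (Fin n → ℝ) → (Fin r → Fin n → ℝ) → ℝ}
    {ω : (Fin n → ℝ) → (Fin n → ℝ) [⋀^Fin r]→L[ℝ] ℝ} (hω : ContDiffOn ℝ (⊤ : ℕ∞) ω U)
    (hL : ∀ x ∈ U, L x = ω x) : IsEvenForm U L := by
  refine ⟨?_, ?_, ?_⟩
  · have hsmooth : ContDiffOn ℝ (⊤ : ℕ∞)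
        (fun q : (Fin n → ℝ) × (Fin r → Fin n → ℝ) => ω q.1 q.2) (U ×ˢ Set.univ) := by
      let f : ((Fin n → ℝ) [⋀^Fin r]→L[ℝ] ℝ) →L[ℝ]
          ContinuousMultilinearMap ℝ (fun _ : Fin r => Fin n → ℝ) ℝ :=
        ContinuousAlternatingMap.toContinuousMultilinearMapCLM ℝ
      have hf : ContDiff ℝ (⊤ : ℕ∞)
          (fun p : ((Fin n → ℝ) [⋀^Fin r]→L[ℝ] ℝ) × (Fin r → Fin n → ℝ) => f p.1 p.2) :=
        contDiff_iff_contDiffAt.2 fun _ => f.analyticAt_uncurry_of_multilinear.contDiffAt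
      exact hf.comp_contDiffOn
        ((hω.comp contDiffOn_fst fun _ hq => hq.1).prodMk contDiffOn_snd)
    exact hsmooth.congr fun q hq => by rw [hL q.1 hq.1]
  · intro x hx m h _
    rw [hL x hx]
    exact alternating_mmul (ω x).toAlternatingMap h m
  · intro x hx
    rw [hL x hx]
    exact fundEqs_alternating (ω x).toAlternatingMap

/-- A function differentiable at the origin and homogeneous of degree one is linear. -/
theorem eq_fderiv_zero_of_homogeneous {E : Type*} [NormedAddCommGroup E] [NormedSpace ℝ E]
    {f : E → ℝ} (hf : DifferentiableAt ℝ f 0)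
    (hom : ∀ c : ℝ, c ≠ 0 → ∀ v, f (c • v) = c * f v) (v : E) :
    f v = fderiv ℝ f 0 v := by
  have h0 : f 0 = 0 := by
    have := hom 2 two_ne_zero 0
    rw [smul_zero] at this
    linarith
  have hall : ∀ c : ℝ, f (c • v) = c * f v := by
    intro c
    rcases eq_or_ne c 0 with rfl | hc
    · simp [h0]
    · exact hom c hc v
  have hd := (hf.hasFDerivAt.hasLineDerivAt v).lineDeriv
  simpa [lineDeriv, hall] using hd

theorem exists_alternating {n r : ℕ} {g : (Fin r → Fin n → ℝ) → ℝ} (hg : Differentiable ℝ g)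
    (hcov : ∀ (m : Fin r → Fin n → ℝ) (h : Fin r → Fin r → ℝ), fdet h ≠ 0 →
      g (mmul h m) = fdet h * g m) :
    ∃ ω : (Fin n → ℝ) [⋀^Fin r]→L[ℝ] ℝ, g = ω := by
  have hlin : ∀ (m : Fin r → Fin n → ℝ) (i : Fin r),
      ∃ l : (Fin n → ℝ) →L[ℝ] ℝ, ∀ v, g (Function.update m i v) = l v := by
    intro m i
    refine ⟨fderiv ℝ (fun v => g (Function.update m i v)) 0,
      eq_fderiv_zero_of_homogeneous ?_ ?_⟩
    · exact (hg _).comp _ (hasFDerivAt_update m 0).differentiableAt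
    · intro c hc v
      have hdet : fdet (Matrix.diagonal (Function.update 1 i c) : Matrix (Fin r) (Fin r) ℝ) = c := by
        change Matrix.det (Matrix.diagonal _) = c
        rw [Matrix.det_diagonal, Finset.prod_update_of_mem (Finset.mem_univ i)]
        simp
      have := hcov (Function.update m i v) _ (hdet.symm ▸ hc)
      rw [hdet] at this
      rw [← this]
      congr 1
      ext k l
      by_cases hk : k = i
      · subst hk; simp [mmul, Matrix.diagonal_apply]
      · simp [mmul, Matrix.diagonal_apply, hk]
  let f : (Fin n → ℝ) [⋀^Fin r]→ₗ[ℝ] ℝ :=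
    { toFun := g
      map_update_add' := by
        intro _ m i x y
        obtain ⟨l, hl⟩ := hlin m i
        have := hl (x + y)
        rw [map_add, ← hl, ← hl] at this
        convert this
      map_update_smul' := by
        intro _ m i c x
        obtain ⟨l, hl⟩ := hlin m i
        have := hl (c • x)
        rw [map_smul, ← hl] at this
        convert this
      map_eq_zero_of_eq' := by
        intro m i j hm hij
        have hdet : fdet ((Equiv.swap i j).permMatrix ℝ : Matrix (Fin r) (Fin r) ℝ) = -1 := by
          change Matrix.det (Equiv.Perm.permMatrix ℝ _) = -1
          rw [Matrix.det_permutation, Equiv.Perm.sign_swap hij]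
          simp
        have hinv : mmul ((Equiv.swap i j).permMatrix ℝ : Matrix (Fin r) (Fin r) ℝ) m = m := by
          ext k l
          have hk : m (Equiv.swap i j k) = m k := by
            by_cases h1 : k = i
            · subst h1; simp [hm]
            · by_cases h2 : k = j
              · subst h2; simp [hm]
              · rw [Equiv.swap_apply_of_ne_of_ne h1 h2]
          simp [mmul, Equiv.Perm.permMatrix, PEquiv.toMatrix_apply, hk]
        have := hcov m _ (hdet.trans_ne (by norm_num))
        rw [hdet, hinv] at this
        linarith }
  exact ⟨{ f with cont := hg.continuous }, rfl⟩

/-- A family of alternating maps is smooth if all its evaluations are. -/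
theorem contDiffOn_alternating {n r : ℕ} {U : Set (Fin n → ℝ)}
    {ω : (Fin n → ℝ) → (Fin n → ℝ) [⋀^Fin r]→L[ℝ] ℝ}
    (hω : ∀ m, ContDiffOn ℝ (⊤ : ℕ∞) (fun x => ω x m) U) : ContDiffOn ℝ (⊤ : ℕ∞) ω U := by
  let T : ((Fin n → ℝ) [⋀^Fin r]→L[ℝ] ℝ) →ₗ[ℝ] ((Fin r → Fin n) → ℝ) :=
    { toFun := fun f I => f fun i => Pi.single (I i) 1
      map_add' := fun _ _ => rfl
      map_smul' := fun _ _ => rfl }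
  have hT : LinearMap.ker T = ⊥ := by
    rw [LinearMap.ker_eq_bot]
    intro f g hfg
    apply ContinuousAlternatingMap.toAlternatingMap_injective
    refine Module.Basis.ext_alternating (Pi.basisFun ℝ (Fin n)) fun I _ => ?_
    simpa [T] using congrFun hfg I
  obtain ⟨S, hS⟩ := T.exists_leftInverse_of_injective hT
  have hcomp : ω = fun x => S.toContinuousLinearMap (T (ω x)) :=
    funext fun x => (LinearMap.congr_fun hS (ω x)).symm
  rw [hcomp]
  exact S.toContinuousLinearMap.contDiff.comp_contDiffOn (contDiffOn_pi.2 fun I => hω _)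

theorem IsEvenForm.exists_alternating {n r : ℕ} {U : Set (Fin n → ℝ)}
    {L : (Fin n → ℝ) → (Fin r → Fin n → ℝ) → ℝ} (hL : IsEvenForm U L) :
    ∃ ω : (Fin n → ℝ) → (Fin n → ℝ) [⋀^Fin r]→L[ℝ] ℝ,
      ContDiffOn ℝ (⊤ : ℕ∞) ω U ∧ ∀ x ∈ U, L x = ω x := by
  obtain ⟨hsmooth, hcov, -⟩ := hL
  have hex : ∀ x, ∃ ω : (Fin n → ℝ) [⋀^Fin r]→L[ℝ] ℝ, x ∈ U → L x = ω := by
    intro x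
    by_cases hx : x ∈ U
    · have hd : ContDiff ℝ (⊤ : ℕ∞) (L x) := by
        rw [← contDiffOn_univ]
        exact hsmooth.comp (contDiff_prodMk_right x).contDiffOn fun m _ => ⟨hx, trivial⟩
      obtain ⟨ω, hω⟩ := _root_.exists_alternating (hd.differentiable (by simp)) (hcov x hx)
      exact ⟨ω, fun _ => hω⟩
    · exact ⟨0, fun h => absurd h hx⟩
  choose ω hω using hex
  refine ⟨ω, contDiffOn_alternating fun m => ?_, hω⟩
  have hm : ContDiffOn ℝ (⊤ : ℕ∞) (fun x => L x m) U :=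
    hsmooth.comp (contDiff_prodMk_left m).contDiffOn fun x hx => ⟨hx, trivial⟩
  exact hm.congr fun x hx => by rw [hω x hx]

/-- Moving the last vector of a tuple to the place of the `i`-th one. -/
theorem alternating_removeNth_castSucc {E : Type*} [AddCommGroup E] [Module ℝ E] {r : ℕ}
    (f : E [⋀^Fin r]→ₗ[ℝ] ℝ) (v : Fin (r + 1) → E) (i : Fin r) :
    (-1 : ℝ) ^ (i : ℕ) * f (i.castSucc.removeNth v)
      = -((-1) ^ r * f (Function.update (fun k => v k.castSucc) i (v (Fin.last r)))) := by
  obtain ⟨s, rfl⟩ : ∃ s, r = s + 1 := ⟨r - 1, by have := i.pos; omega⟩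
  have hupd : Function.update (fun k => v (Fin.castSucc k)) i (v (Fin.last (s + 1)))
      = i.insertNth (v (Fin.last (s + 1))) (i.removeNth fun k => v (Fin.castSucc k)) := by
    simp
  have hrem : i.castSucc.removeNth v = (Fin.last s).insertNth (v (Fin.last (s + 1)))
      (i.removeNth fun k => v (Fin.castSucc k)) := by
    rw [Fin.insertNth_last']
    funext k
    refine Fin.lastCases ?_ (fun k => ?_) k
    · simp [Fin.removeNth]
    · simp [Fin.removeNth, Fin.castSucc_succAbove_castSucc]
  rw [hupd, hrem, f.map_insertNth, f.map_insertNth]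
  simp only [zsmul_eq_mul, Fin.val_last]
  push_cast
  ring

theorem Dform_eq_extDeriv {n r : ℕ} {U : Set (Fin n → ℝ)} (hU : IsOpen U)
    {L : (Fin n → ℝ) → (Fin r → Fin n → ℝ) → ℝ}
    {ω : (Fin n → ℝ) → (Fin n → ℝ) [⋀^Fin r]→L[ℝ] ℝ} (hω : ContDiffOn ℝ (⊤ : ℕ∞) ω U)
    (hL : ∀ x ∈ U, L x = ω x) {x : Fin n → ℝ} (hx : x ∈ U) :
    Dform L x = extDeriv ω x := by
  have hnhds : ∀ᶠ y in 𝓝 x, y ∈ U := hU.mem_nhds hx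
  have hd : DifferentiableAt ℝ ω x :=
    (hω.contDiffAt (hU.mem_nhds hx)).differentiableAt (by simp)
  have hfd : ∀ m v, fderiv ℝ (fun y => ω y m) x v = fderiv ℝ ω x v m := fun m v => by
    rw [fderiv_continuousAlternatingMap_apply_const_apply hd]
  have hdm : ∀ m, DifferentiableAt ℝ (fun y => ω y m) x := fun m => by fun_prop
  have hpdV : ∀ {f : (Fin n → ℝ) → ℝ} (m) (i : Fin n), (∀ y ∈ U, f y = ω y m) →
      pdV f i x = fderiv ℝ ω x (Pi.single i 1) m := by
    intro f m i hf
    have heq : f =ᶠ[𝓝 x] fun y => ω y m := hnhds.mono hf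
    rw [pdV_eq_fderiv (heq.differentiableAt_iff.2 (hdm m)), heq.fderiv_eq, hfd]
  funext M
  set y := M (Fin.last r) with hy
  set xd : Fin r → Fin n → ℝ := fun F => M (Fin.castSucc F) with hxd
  have hfirst : ∀ A, pdV (fun x' => L x' xd) A x = fderiv ℝ ω x (Pi.single A 1) xd :=
    fun A => hpdV _ A fun z hz => by rw [hL z hz]
  have hsecond : ∀ F A B, pdV (fun x' => pdM (L x') F A xd) B x
      = fderiv ℝ ω x (Pi.single B 1) (Function.update xd F (Pi.single A 1)) :=
    fun F A B => hpdV _ B fun z hz => by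
      rw [hL z hz]
      exact pdM_multilinear (ω z).toMultilinearMap F A xd
  have hexpand : ∀ v : Fin n → ℝ, v = ∑ A, v A • Pi.single A (1 : ℝ) := fun v => by
    simpa using (pi_eq_sum_univ' v)
  have hsum₁ : ∀ (v : Fin n → ℝ) m,
      ∑ A, v A * fderiv ℝ ω x (Pi.single A 1) m = fderiv ℝ ω x v m := by
    intro v m
    conv_rhs => rw [hexpand v]
    simp [ContinuousAlternatingMap.sum_apply]
  have hsum₂ : ∀ (η : (Fin n → ℝ) [⋀^Fin r]→L[ℝ] ℝ) (F : Fin r) (v : Fin n → ℝ),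
      ∑ A, v A * η (Function.update xd F (Pi.single A 1)) = η (Function.update xd F v) := by
    intro η F v
    have := map_sum (η.toContinuousLinearMap xd F) (fun A => v A • Pi.single A (1 : ℝ))
      Finset.univ
    rw [← hexpand v] at this
    simpa using this.symm
  have hcorr : ∑ A, y A * ∑ F, ∑ B, xd F B * pdV (fun x' => pdM (L x') F A xd) B x
      = ∑ F, fderiv ℝ ω x (xd F) (Function.update xd F y) := by
    simp only [hsecond, hsum₁, Finset.mul_sum]
    rw [Finset.sum_comm]
    simp only [hsum₂]
  rw [extDeriv_apply hd, Fin.sum_univ_castSucc]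
  have hD : Dform L x M = (-1) ^ r * (∑ A, y A * pdV (fun x' => L x' xd) A x
      - ∑ A, y A * ∑ F, ∑ B, xd F B * pdV (fun x' => pdM (L x') F A xd) B x) := by
    simp only [Dform, mul_sub, Finset.sum_sub_distrib, hy, hxd]
  rw [hD, hcorr]
  simp only [hfirst, hsum₁, hfd]
  have hlast : (Fin.last r).removeNth M = xd := by
    funext k; simp [Fin.removeNth, hxd]
  have hterm : ∀ F : Fin r, (-1 : ℤ) ^ (F.castSucc : ℕ) •
      fderiv ℝ ω x (M F.castSucc) (F.castSucc.removeNth M)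
      = -((-1) ^ r * fderiv ℝ ω x (xd F) (Function.update xd F y)) := by
    intro F
    have := alternating_removeNth_castSucc (fderiv ℝ ω x (M F.castSucc)).toAlternatingMap M F
    simpa [zsmul_eq_mul] using this
  rw [Finset.sum_congr rfl fun F _ => hterm F, hlast, Finset.sum_neg_distrib, ← Finset.mul_sum]
  simp [zsmul_eq_mul]
  ring

/-- The differential `ΔL` of an even `r`-form `L` on an open
`U ⊆ ℝⁿ` is an even `(r+1)`-form on `U`, and `Δ(ΔL) = 0`. -/
theorem statement_4 (n r : ℕ) (U : Set (Fin n → ℝ)) (hU : IsOpen U)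
    (L : (Fin n → ℝ) → (Fin r → Fin n → ℝ) → ℝ) (hL : IsEvenForm U L) :
    IsEvenForm U (Dform L) ∧
    ∀ x ∈ U, ∀ M : Fin (r + 2) → Fin n → ℝ, Dform (Dform L) x M = 0 := by
  obtain ⟨ω, hω, hLω⟩ := hL.exists_alternating
  have hdω : ContDiffOn ℝ (⊤ : ℕ∞) (extDeriv ω) U :=
    (ContinuousAlternatingMap.alternatizeUncurryFinCLM ℝ (Fin n → ℝ) ℝ).contDiff.comp_contDiffOn
      (hω.fderiv_of_isOpen hU (by simp))
  have hDL : ∀ x ∈ U, Dform L x = extDeriv ω x := fun x hx => Dform_eq_extDeriv hU hω hLω hx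
  refine ⟨isEvenForm_of_alternating hdω hDL, fun x hx M => ?_⟩
  rw [Dform_eq_extDeriv hU hdω hDL hx,
    extDeriv_extDeriv_apply (hω.contDiffAt (hU.mem_nhds hx))
      (by rw [minSmoothness_of_isRCLikeNormedField]; exact WithTop.coe_le_coe.2 (le_top : (2 : ℕ∞) ≤ ⊤))]
  rfl
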